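/- For every x⃗ ∈ ℝ³ and every x₄ > 0, the value of the analytic continuation f at the purely Euclidean point (−i x₄, x⃗) equals the iterated Fourier integral of the Euclidean propagator: (2π)^{−3} ∫_{ℝ³} e^{i⟨k, x⃗⟩ − ω(k) x₄} / (2ω(k)) dk = (2π)^{−4} ∫_{ℝ³} ( ∫_{ℝ} e^{i(⟨k, x⃗⟩ + k₄ x₄)} / (|k|² + k₄² + m²) dk₄ ) dk, where both the inner integral over k₄ ∈ ℝ and the outer integral over k ∈ ℝ³ converge absolutely. This identifies the Schwinger function s(x⃗, x₄) of the free scalar field of mass m on the half-space x₄ > 0. -/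

import Mathlib

open MeasureTheory

/-- The on-shell energy `ω(k) = √(|k|² + m²)` for `k ∈ ℝ³`. -/
noncomputable def omega (m : ℝ) (k : Fin 3 → ℝ) : ℝ :=
  Real.sqrt ((∑ i, k i ^ 2) + m ^ 2)

section PropagatorIntegral

open Complex

open scoped FourierTransform

theorem integrable_exp_neg_mul_abs {a : ℝ} (ha : 0 < a) :
    Integrable (fun t : ℝ => Real.exp (-a * |t|)) := by
  rw [← integrableOn_univ, ← Set.Iic_union_Ioi (a := (0 : ℝ))]
  refine IntegrableOn.union ?_ ?_
  · refine (integrableOn_exp_mul_Iic ha 0).congr_fun (fun t ht => ?_) measurableSet_Iic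
    simp [abs_of_nonpos (Set.mem_Iic.1 ht)]
  · refine (integrableOn_exp_mul_Ioi (neg_lt_zero.2 ha) 0).congr_fun (fun t ht => ?_)
      measurableSet_Ioi
    simp [abs_of_pos (Set.mem_Ioi.1 ht)]

theorem integrable_inv_sq_add_sq {w : ℝ} (hw : 0 < w) :
    Integrable (fun p : ℝ => (w ^ 2 + p ^ 2)⁻¹) := by
  refine ((integrable_inv_one_add_sq.comp_div hw.ne').const_mul (w ^ 2)⁻¹).congr
    (Filter.Eventually.of_forall fun p => ?_)
  have : 0 < w ^ 2 + p ^ 2 := by positivity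
  dsimp only
  field_simp

theorem fourier_exp_neg_mul_abs {w : ℝ} (hw : 0 < w) (ξ : ℝ) :
    𝓕 (fun t : ℝ => ((Real.exp (-w * |t|) : ℝ) : ℂ)) ξ =
      ((2 * w * (w ^ 2 + (2 * Real.pi * ξ) ^ 2)⁻¹ : ℝ) : ℂ) := by
  set a : ℂ := w - I * (2 * Real.pi * ξ : ℝ) with ha
  set b : ℂ := -w - I * (2 * Real.pi * ξ : ℝ) with hb
  have ha_re : 0 < a.re := by simpa [ha] using hw
  have hb_re : b.re < 0 := by simpa [hb] using hw
  have hleft : Set.EqOn (fun t : ℝ => cexp (a * t))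
      (fun t : ℝ => cexp (↑(-2 * Real.pi * t * ξ) * I) • ((Real.exp (-w * |t|) : ℝ) : ℂ))
      (Set.Iic 0) := by
    intro t ht
    simp only [smul_eq_mul, ofReal_exp, ← Complex.exp_add, abs_of_nonpos (Set.mem_Iic.1 ht), ha]
    congr 1
    push_cast
    ring
  have hright : Set.EqOn (fun t : ℝ => cexp (b * t))
      (fun t : ℝ => cexp (↑(-2 * Real.pi * t * ξ) * I) • ((Real.exp (-w * |t|) : ℝ) : ℂ))
      (Set.Ioi 0) := by
    intro t ht
    simp only [smul_eq_mul, ofReal_exp, ← Complex.exp_add, abs_of_pos (Set.mem_Ioi.1 ht), hb]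
    congr 1
    push_cast
    ring
  rw [Real.fourier_real_eq_integral_exp_smul, ← setIntegral_univ,
    ← Set.Iic_union_Ioi (a := (0 : ℝ)),
    setIntegral_union (Set.Iic_disjoint_Ioi le_rfl) measurableSet_Ioi
      ((integrableOn_exp_mul_complex_Iic ha_re 0).congr_fun hleft measurableSet_Iic)
      ((integrableOn_exp_mul_complex_Ioi hb_re 0).congr_fun hright measurableSet_Ioi),
    ← setIntegral_congr_fun measurableSet_Iic hleft,
    ← setIntegral_congr_fun measurableSet_Ioi hright,
    integral_exp_mul_complex_Iic ha_re, integral_exp_mul_complex_Ioi hb_re]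
  have ha0 : a ≠ 0 := fun h => by simp [h] at ha_re
  have hb0 : b ≠ 0 := fun h => by simp [h] at hb_re
  have hden : ((w ^ 2 + (2 * Real.pi * ξ) ^ 2 : ℝ) : ℂ) = -(a * b) := by
    rw [ha, hb]
    push_cast
    linear_combination (4 * (Real.pi : ℂ) ^ 2 * ξ ^ 2) * I_sq
  have hnum : ((2 * w : ℝ) : ℂ) = a - b := by
    rw [ha, hb]
    push_cast
    ring
  rw [ofReal_mul, ofReal_inv, hden, hnum]
  simp only [ofReal_zero, mul_zero, Complex.exp_zero]
  field_simp
  ring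

/-- The one-dimensional Fourier integral of the Lorentzian `(w² + p²)⁻¹`. -/
theorem integral_exp_mul_inv_sq_add_sq {w : ℝ} (hw : 0 < w) (t : ℝ) :
    ∫ p : ℝ, cexp (I * ((p * t : ℝ) : ℂ)) * (((w ^ 2 + p ^ 2)⁻¹ : ℝ) : ℂ) =
      ((Real.pi / w * Real.exp (-w * |t|) : ℝ) : ℂ) := by
  have hfour : 𝓕 (fun t : ℝ => ((Real.exp (-w * |t|) : ℝ) : ℂ)) =
      fun ξ => ((2 * w * (w ^ 2 + (2 * Real.pi * ξ) ^ 2)⁻¹ : ℝ) : ℂ) :=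
    funext (fourier_exp_neg_mul_abs hw)
  have hint : Integrable (𝓕 (fun t : ℝ => ((Real.exp (-w * |t|) : ℝ) : ℂ))) := by
    rw [hfour]
    exact (((integrable_inv_sq_add_sq hw).comp_mul_left' Real.two_pi_pos.ne').const_mul
      (2 * w)).ofReal
  have hinv := (integrable_exp_neg_mul_abs hw).ofReal (𝕜 := ℂ)
    |>.fourierInv_fourier_eq hint (v := t) (by fun_prop)
  simp only [coe_algebraMap] at hinv
  rw [hfour, Real.fourierInv_eq'] at hinv
  have hscale := Measure.integral_comp_mul_left
    (fun p : ℝ => cexp (I * ((p * t : ℝ) : ℂ)) * (((w ^ 2 + p ^ 2)⁻¹ : ℝ) : ℂ)) (2 * Real.pi)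
  have hleft : ∫ ξ : ℝ, cexp (↑(2 * Real.pi * inner ℝ ξ t) * I) •
      ((2 * w * (w ^ 2 + (2 * Real.pi * ξ) ^ 2)⁻¹ : ℝ) : ℂ) =
      (2 * w : ℂ) * ∫ ξ : ℝ, cexp (I * ((2 * Real.pi * ξ * t : ℝ) : ℂ)) *
        (((w ^ 2 + (2 * Real.pi * ξ) ^ 2)⁻¹ : ℝ) : ℂ) := by
    rw [← integral_const_mul]
    congr 1 with ξ
    simp only [smul_eq_mul, RCLike.inner_apply, conj_trivial]
    rw [show ((2 * Real.pi * (t * ξ) : ℝ) : ℂ) * I = I * ((2 * Real.pi * ξ * t : ℝ) : ℂ) by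
      push_cast; ring]
    push_cast
    ring
  rw [hleft, hscale, abs_of_pos (by positivity), real_smul] at hinv
  have hw0 : (w : ℂ) ≠ 0 := by exact_mod_cast hw.ne'
  have hpi : (Real.pi : ℂ) ≠ 0 := by exact_mod_cast Real.pi_ne_zero
  set J := ∫ p : ℝ, cexp (I * ((p * t : ℝ) : ℂ)) * (((w ^ 2 + p ^ 2)⁻¹ : ℝ) : ℂ)
  rw [ofReal_mul, ← hinv]
  push_cast
  field_simp

theorem omega_pos {m : ℝ} (hm : 0 < m) (k : Fin 3 → ℝ) : 0 < omega m k :=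
  Real.sqrt_pos.2 (by positivity)

theorem omega_sq (m : ℝ) (k : Fin 3 → ℝ) : omega m k ^ 2 = (∑ i, k i ^ 2) + m ^ 2 :=
  Real.sq_sqrt (by positivity)

theorem le_omega (m : ℝ) (k : Fin 3 → ℝ) : m ≤ omega m k :=
  Real.le_sqrt_of_sq_le (le_add_of_nonneg_left (by positivity))

theorem abs_le_omega (m : ℝ) (k : Fin 3 → ℝ) (i : Fin 3) : |k i| ≤ omega m k := by
  refine Real.le_sqrt_of_sq_le ?_
  rw [sq_abs]
  have := Finset.single_le_sum (f := fun i => k i ^ 2) (fun i _ => sq_nonneg (k i))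
    (Finset.mem_univ i)
  nlinarith [sq_nonneg m]

theorem continuous_omega (m : ℝ) : Continuous (omega m) := by
  unfold omega
  fun_prop

theorem integrable_exp_neg_omega_mul (m : ℝ) {t : ℝ} (ht : 0 < t) :
    Integrable (fun k : Fin 3 → ℝ => Real.exp (-(omega m k * t))) := by
  have hprod : Integrable (fun k : Fin 3 → ℝ => ∏ i, Real.exp (-(t / 3) * |k i|)) :=
    Integrable.fintype_prod fun _ => integrable_exp_neg_mul_abs (by positivity)
  have hcont := continuous_omega m
  refine hprod.mono' (by fun_prop) (Filter.Eventually.of_forall fun k => ?_)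
  rw [Real.norm_of_nonneg (Real.exp_pos _).le, ← Real.exp_sum, Real.exp_le_exp,
    Fin.sum_univ_three]
  nlinarith [abs_le_omega m k 0, abs_le_omega m k 1, abs_le_omega m k 2]

theorem propagator_integrand_eq (m : ℝ) (xv : Fin 3 → ℝ) (t : ℝ) (k : Fin 3 → ℝ) (p : ℝ) :
    cexp (I * (((∑ i, k i * xv i) + p * t : ℝ) : ℂ)) /
        ((((∑ i, k i ^ 2) + p ^ 2 + m ^ 2 : ℝ) : ℂ)) =
      cexp (I * ((∑ i, k i * xv i : ℝ) : ℂ)) *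
        (cexp (I * ((p * t : ℝ) : ℂ)) * (((omega m k ^ 2 + p ^ 2)⁻¹ : ℝ) : ℂ)) := by
  rw [omega_sq, add_right_comm, ofReal_add (∑ i, k i * xv i), mul_add, Complex.exp_add,
    ofReal_inv, div_eq_mul_inv, mul_assoc]

theorem integrable_propagator_integrand {m : ℝ} (hm : 0 < m) (xv : Fin 3 → ℝ) (t : ℝ)
    (k : Fin 3 → ℝ) :
    Integrable (fun p : ℝ => cexp (I * (((∑ i, k i * xv i) + p * t : ℝ) : ℂ)) /
      ((((∑ i, k i ^ 2) + p ^ 2 + m ^ 2 : ℝ) : ℂ))) := by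
  simp only [propagator_integrand_eq]
  refine Integrable.const_mul ?_ _
  refine (integrable_inv_sq_add_sq (omega_pos hm k)).ofReal.bdd_mul (c := 1)
    (by fun_prop) (Filter.Eventually.of_forall fun p => ?_)
  rw [norm_exp_I_mul_ofReal]

theorem integral_propagator_integrand {m : ℝ} (hm : 0 < m) (xv : Fin 3 → ℝ) {t : ℝ}
    (ht : 0 < t) (k : Fin 3 → ℝ) :
    ∫ p : ℝ, cexp (I * (((∑ i, k i * xv i) + p * t : ℝ) : ℂ)) /
        ((((∑ i, k i ^ 2) + p ^ 2 + m ^ 2 : ℝ) : ℂ)) =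
      2 * Real.pi * (cexp (I * ((∑ i, k i * xv i : ℝ) : ℂ) - ((omega m k * t : ℝ) : ℂ)) /
        (2 * (omega m k : ℂ))) := by
  simp only [propagator_integrand_eq]
  rw [integral_const_mul, integral_exp_mul_inv_sq_add_sq (omega_pos hm k), abs_of_pos ht,
    sub_eq_add_neg, Complex.exp_add, neg_mul]
  have : (omega m k : ℂ) ≠ 0 := by exact_mod_cast (omega_pos hm k).ne'
  push_cast
  field_simp

theorem integrable_onShell_integrand {m : ℝ} (hm : 0 < m) (xv : Fin 3 → ℝ) {t : ℝ}
    (ht : 0 < t) :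
    Integrable (fun k : Fin 3 → ℝ =>
      cexp (I * ((∑ i, k i * xv i : ℝ) : ℂ) - ((omega m k * t : ℝ) : ℂ)) /
        (2 * (omega m k : ℂ))) := by
  have hcont := continuous_omega m
  refine ((integrable_exp_neg_omega_mul m ht).const_mul (2 * m)⁻¹).mono' ?_
    (Filter.Eventually.of_forall fun k => ?_)
  · refine Continuous.aestronglyMeasurable (Continuous.div (by fun_prop) (by fun_prop) fun k => ?_)
    exact_mod_cast (mul_pos two_pos (omega_pos hm k)).ne'
  · have hω := omega_pos hm k
    rw [norm_div, norm_exp, norm_mul, norm_real, Real.norm_of_nonneg hω.le, div_eq_inv_mul]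
    simp only [sub_re, I_mul_re, ofReal_im, ofReal_re, neg_zero, zero_sub, norm_ofNat]
    gcongr
    exact le_omega m k

end PropagatorIntegral

/-- For every `x⃗ ∈ ℝ³` and `x₄ > 0`, the value of the analytic continuation `f` at the
Euclidean point `(−i x₄, x⃗)`, namely `(2π)⁻³ ∫ e^{i⟨k,x⃗⟩ − ω(k)x₄}/(2ω(k)) dk`, equals the
iterated Fourier integral `(2π)⁻⁴ ∫_{ℝ³} ∫_ℝ e^{i(⟨k,x⃗⟩ + k₄x₄)}/(|k|² + k₄² + m²) dk₄ dk`
of the Euclidean propagator, both the inner and the outer integrals converging absolutely.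
This identifies the Schwinger function `s(x⃗, x₄)` on the half-space `x₄ > 0`. -/
theorem schwinger_function_halfspace (m : ℝ) (hm : 0 < m)
    (xv : Fin 3 → ℝ) (x₄ : ℝ) (hx₄ : 0 < x₄) :
    (∀ k : Fin 3 → ℝ, Integrable (fun k₄ : ℝ =>
      Complex.exp (Complex.I * (((∑ i, k i * xv i) + k₄ * x₄ : ℝ) : ℂ)) /
        ((((∑ i, k i ^ 2) + k₄ ^ 2 + m ^ 2 : ℝ) : ℂ)))) ∧
    Integrable (fun k : Fin 3 → ℝ =>
      ∫ k₄ : ℝ, Complex.exp (Complex.I * (((∑ i, k i * xv i) + k₄ * x₄ : ℝ) : ℂ)) /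
        ((((∑ i, k i ^ 2) + k₄ ^ 2 + m ^ 2 : ℝ) : ℂ))) ∧
    ((((2 * Real.pi) ^ 3)⁻¹ : ℝ) : ℂ) *
      ∫ k : Fin 3 → ℝ,
        Complex.exp (Complex.I * ((∑ i, k i * xv i : ℝ) : ℂ) - ((omega m k * x₄ : ℝ) : ℂ)) /
          (2 * (omega m k : ℂ)) =
    ((((2 * Real.pi) ^ 4)⁻¹ : ℝ) : ℂ) *
      ∫ k : Fin 3 → ℝ,
        ∫ k₄ : ℝ, Complex.exp (Complex.I * (((∑ i, k i * xv i) + k₄ * x₄ : ℝ) : ℂ)) /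
          ((((∑ i, k i ^ 2) + k₄ ^ 2 + m ^ 2 : ℝ) : ℂ)) := by
  refine ⟨integrable_propagator_integrand hm xv x₄, ?_, ?_⟩
  · simp only [integral_propagator_integrand hm xv hx₄]
    exact (integrable_onShell_integrand hm xv hx₄).const_mul _
  · simp only [integral_propagator_integrand hm xv hx₄]
    rw [integral_const_mul, ← mul_assoc]
    congr 1
    have hpi : (Real.pi : ℂ) ≠ 0 := by exact_mod_cast Real.pi_ne_zero
    push_cast
    field_simp
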